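/- Let d ≥ 1 and let V : ℝ^d → ℝ be bounded and measurable with V(x) → 0 as |x| → ∞. Assume there exist constants c ∈ (0,∞) and ρ ∈ (2,∞) such that V_-(x) ≤ c(1+|x|)^{-ρ} for all x ∈ ℝ^d, where V_- := max(-V, 0). Then N(0; V) < ∞, i.e. the Schrödinger operator -Δ + V has at most finitely many negative eigenvalues. -/

import Mathlib

open MeasureTheory Filter Real Set Topology

noncomputable section

abbrev Ed (d : ℕ) := EuclideanSpace ℝ (Fin d)

/-- Glazman variational count of eigenvalues of `-Δ + V` below `E`. -/
noncomputable def schN (d : ℕ) (V : Ed d → ℝ) (E : ℝ) : ℕ∞ :=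
  ⨆ F : {F : Submodule ℝ (Ed d → ℝ) //
      (∀ u ∈ F, ContDiff ℝ (⊤ : ℕ∞) u ∧ HasCompactSupport u) ∧
      (∀ u ∈ F, u ≠ 0 →
        (∫ x, (‖gradient u x‖ ^ 2 + V x * u x ^ 2)) < E * ∫ x, u x ^ 2)},
    (Module.finrank ℝ F.1 : ℕ∞)

/-- Laplacian. -/
noncomputable def lap (d : ℕ) (φ : Ed d → ℝ) (x : Ed d) : ℝ :=
  ∑ i : Fin d, iteratedFDeriv ℝ 2 φ x ![EuclideanSpace.single i 1, EuclideanSpace.single i 1]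

/-- The symbol class `S_{m,ρ}`. -/
def SClass (d m : ℕ) (ρ : ℝ) (W : Ed d → ℝ) : Prop :=
  ContDiff ℝ m W ∧ ∃ C : ℝ, 0 < C ∧ ∀ k : ℕ, k ≤ m → ∀ x : Ed d,
    ‖iteratedFDeriv ℝ k W x‖ ≤ C * (1 + ‖x‖) ^ (-ρ - (k : ℝ))

/-- The cube `(-R/2, R/2)^d`. -/
def cube (d : ℕ) (R : ℝ) : Set (Ed d) := {x | ∀ i, |x i| < R / 2}

/-- Admissibility of `η` with mean value `η₀` witnessed by the solution `φ` of `Δφ = η - η₀`. -/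
structure IsAdmissible (d : ℕ) (η : Ed d → ℝ) (η₀ : ℝ) (φ : Ed d → ℝ) : Prop where
  background_ne : ∃ x, η x ≠ η₀
  smooth : ContDiff ℝ 2 φ
  bounded : ∀ k : ℕ, k ≤ 2 → ∃ M : ℝ, ∀ x, ‖iteratedFDeriv ℝ k φ x‖ ≤ M
  poisson : ∀ x, lap d φ x = η x - η₀
  normalized : Filter.limsup (fun R : ℝ => (∫ x in cube d R, φ x) / R ^ d) Filter.atTop = 0

/-- Volume of the unit ball of `ℝ^d`. -/
noncomputable def tau (d : ℕ) : ℝ := (volume (Metric.ball (0 : Ed d) 1)).toReal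

/-- Semiclassical counting function. -/
noncomputable def Ncl (d : ℕ) (V : Ed d → ℝ) (E : ℝ) : ℝ :=
  (tau d / (2 * π) ^ d) * ∫ x, (max (E - V x) 0) ^ ((d : ℝ) / 2)



lemma norm_gradient_eq {d : ℕ} (u : Ed d → ℝ) (x : Ed d) :
    ‖gradient u x‖ = ‖fderiv ℝ u x‖ := by
  unfold gradient
  exact LinearIsometryEquiv.norm_map _ _

lemma jensen_sq {α : Type*} [MeasurableSpace α] (μ : Measure α) [IsProbabilityMeasure μ]
    (f : α → ℝ) (hf : Integrable f μ) (hf2 : Integrable (fun x => f x ^ 2) μ) :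
    ENNReal.ofReal ((∫ x, f x ∂μ) ^ 2) ≤ ∫⁻ x, ENNReal.ofReal (f x ^ 2) ∂μ := by
  rw [← ofReal_integral_eq_lintegral_ofReal hf2 (ae_of_all _ fun x => sq_nonneg _)]
  apply ENNReal.ofReal_le_ofReal
  set m := ∫ x, f x ∂μ with hm
  have h0 : 0 ≤ ∫ x, (f x - m) ^ 2 ∂μ := integral_nonneg fun x => sq_nonneg _
  have h1 : ∫ x, (f x - m) ^ 2 ∂μ = ∫ x, (f x ^ 2 - (2 * m) * f x + m ^ 2) ∂μ := by
    congr 1; ext x; ring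
  have i1 : Integrable (fun x => f x ^ 2 - (2 * m) * f x) μ := hf2.sub (hf.const_mul _)
  rw [h1, integral_add i1 (integrable_const _), integral_sub hf2 (hf.const_mul _),
    integral_const_mul, ← hm] at h0
  simp at h0
  nlinarith

lemma transl_bound {d : ℕ} (u : Ed d → ℝ) (hu : ContDiff ℝ 1 u) (v : Ed d) :
    ∫⁻ x, ENNReal.ofReal ((u (x + v) - u x) ^ 2) ≤
      ENNReal.ofReal (‖v‖ ^ 2) * ∫⁻ x, ENNReal.ofReal (‖fderiv ℝ u x‖ ^ 2) := by
  have hdc : Continuous (fderiv ℝ u) := hu.continuous_fderiv (by norm_num)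
  let μ : Measure ℝ := volume.restrict (Ioc 0 1)
  have : IsProbabilityMeasure μ := ⟨by simp [μ]⟩
  have key : ∀ x, ENNReal.ofReal ((u (x + v) - u x) ^ 2) ≤
      ∫⁻ t, ENNReal.ofReal (‖v‖ ^ 2) * ENNReal.ofReal (‖fderiv ℝ u (x + t • v)‖ ^ 2) ∂μ := by
    intro x
    have hc : Continuous (fun t : ℝ => fderiv ℝ u (x + t • v) v) := by fun_prop
    have hder : ∀ t : ℝ, HasDerivAt (fun t : ℝ => u (x + t • v)) (fderiv ℝ u (x + t • v) v) t := by
      intro t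
      have h1 : HasDerivAt (fun t : ℝ => x + t • v) v t := by
        simpa using ((hasDerivAt_id t).smul_const v).const_add x
      exact ((hu.differentiable (by norm_num)) (x + t • v)).hasFDerivAt.comp_hasDerivAt t h1
    have hft : ∫ t in (0:ℝ)..1, fderiv ℝ u (x + t • v) v = u (x + v) - u x := by
      rw [intervalIntegral.integral_eq_sub_of_hasDerivAt (fun t _ => hder t)
        (hc.intervalIntegrable _ _)]
      simp
    rw [intervalIntegral.integral_of_le zero_le_one] at hft
    have hi : Integrable (fun t : ℝ => fderiv ℝ u (x + t • v) v) μ :=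
      (hc.integrableOn_Icc (a := 0) (b := 1)).mono_set Ioc_subset_Icc_self
    have hi2 : Integrable (fun t : ℝ => (fderiv ℝ u (x + t • v) v) ^ 2) μ :=
      ((hc.pow 2).integrableOn_Icc (a := 0) (b := 1)).mono_set Ioc_subset_Icc_self
    have := jensen_sq μ _ hi hi2
    rw [← hft]
    refine this.trans (lintegral_mono fun t => ?_)
    rw [← ENNReal.ofReal_mul (by positivity)]
    apply ENNReal.ofReal_le_ofReal
    have h := (fderiv ℝ u (x + t • v)).le_opNorm v
    rw [Real.norm_eq_abs] at h
    calc (fderiv ℝ u (x + t • v) v) ^ 2 = |fderiv ℝ u (x + t • v) v| ^ 2 := (sq_abs _).symm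
      _ ≤ (‖fderiv ℝ u (x + t • v)‖ * ‖v‖) ^ 2 := by gcongr
      _ = _ := by ring
  calc _ ≤ ∫⁻ x, ∫⁻ t, ENNReal.ofReal (‖v‖ ^ 2) *
          ENNReal.ofReal (‖fderiv ℝ u (x + t • v)‖ ^ 2) ∂μ := lintegral_mono key
    _ = ∫⁻ t, ∫⁻ x, ENNReal.ofReal (‖v‖ ^ 2) *
          ENNReal.ofReal (‖fderiv ℝ u (x + t • v)‖ ^ 2) ∂volume ∂μ := by
        apply lintegral_lintegral_swap
        apply Measurable.aemeasurable
        apply Measurable.const_mul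
        apply ENNReal.measurable_ofReal.comp
        apply Continuous.measurable
        fun_prop
    _ = ∫⁻ _t, (ENNReal.ofReal (‖v‖ ^ 2) * ∫⁻ x : Ed d, ENNReal.ofReal (‖fderiv ℝ u x‖ ^ 2)) ∂μ := by
        refine lintegral_congr fun t => ?_
        rw [lintegral_const_mul' _ _ ENNReal.ofReal_ne_top,
          lintegral_add_right_eq_self (fun x => ENNReal.ofReal (‖fderiv ℝ u x‖ ^ 2)) (t • v)]
    _ = _ := by simp

lemma local_bound {d : ℕ} (u : Ed d → ℝ) (hu : ContDiff ℝ 1 u) (h δ R : ℝ)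
    (hh : 0 < h) (hδ : 0 < δ) (t : Set (Ed d))
    (ht : ∀ x ∈ Metric.closedBall (0 : Ed d) R, ∃ p ∈ t, dist x p < δ)
    (h0 : ∀ p ∈ t, ∫ v in Metric.ball (0 : Ed d) h, u (p + v) = 0) :
    ∫⁻ x in Metric.closedBall (0 : Ed d) R, ENNReal.ofReal (u x ^ 2) ≤
      2 * (ENNReal.ofReal (h ^ 2) + (volume (Metric.ball (0 : Ed d) h))⁻¹ * ENNReal.ofReal (δ ^ 2)
        * volume (Metric.closedBall (0 : Ed d) R)) *
        ∫⁻ x, ENNReal.ofReal (‖fderiv ℝ u x‖ ^ 2) := by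
  set B := Metric.ball (0 : Ed d) h with hB
  set G := ∫⁻ x, ENNReal.ofReal (‖fderiv ℝ u x‖ ^ 2) with hG
  have hB0 : volume B ≠ 0 := (Metric.measure_ball_pos volume 0 hh).ne'
  have hBt : volume B ≠ ⊤ := measure_ball_lt_top.ne
  let μ : Measure (Ed d) := (volume B)⁻¹ • volume.restrict B
  have : IsProbabilityMeasure μ := ⟨by simp [μ, ENNReal.inv_mul_cancel hB0 hBt]⟩
  have huc := hu.continuous
  have hint : ∀ f : Ed d → ℝ, Continuous f → Integrable f μ := by
    intro f hf
    have : IntegrableOn f B volume :=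
      (hf.continuousOn.integrableOn_compact (isCompact_closedBall (0 : Ed d) h)).mono_set
        Metric.ball_subset_closedBall
    exact Integrable.smul_measure this (ENNReal.inv_ne_top.2 hB0)
  have key : ∀ x ∈ Metric.closedBall (0 : Ed d) R, ENNReal.ofReal (u x ^ 2) ≤
      2 * ∫⁻ v, ENNReal.ofReal ((u (x + v) - u x) ^ 2) ∂μ +
      2 * ((volume B)⁻¹ * (ENNReal.ofReal (δ ^ 2) * G)) := by
    intro x hx
    obtain ⟨p, hp, hxp⟩ := ht x hx
    have c1 : Continuous fun v => u (x + v) - u x := by fun_prop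
    have c2 : Continuous fun v => u (x + v) - u (p + v) := by fun_prop
    have j1 := jensen_sq μ _ (hint _ c1) (hint _ (c1.pow 2))
    have j2 := jensen_sq μ _ (hint _ c2) (hint _ (c2.pow 2))
    have cx : Continuous fun v => u (x + v) := by fun_prop
    have cp : Continuous fun v => u (p + v) := by fun_prop
    have hp0 : ∫ v, u (p + v) ∂μ = 0 := by
      simp only [μ, integral_smul_measure, h0 p hp, smul_zero]
    have e1 : ∫ v, (u (x + v) - u x) ∂μ = (∫ v, u (x + v) ∂μ) - u x := by
      rw [integral_sub (hint _ cx) (integrable_const _)]; simp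
    have e2 : ∫ v, (u (x + v) - u (p + v)) ∂μ = ∫ v, u (x + v) ∂μ := by
      rw [integral_sub (hint _ cx) (hint _ cp), hp0, sub_zero]
    rw [e1] at j1
    rw [e2] at j2
    set m := ∫ v, u (x + v) ∂μ
    have b2 : ∫⁻ v, ENNReal.ofReal ((u (x + v) - u (p + v)) ^ 2) ∂μ ≤
        (volume B)⁻¹ * (ENNReal.ofReal (δ ^ 2) * G) := by
      simp only [μ, lintegral_smul_measure, smul_eq_mul]
      gcongr
      calc _ ≤ ∫⁻ v, ENNReal.ofReal ((u (x + v) - u (p + v)) ^ 2) := setLIntegral_le_lintegral _ _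
        _ = ∫⁻ v, ENNReal.ofReal ((u ((v + p) + (x - p)) - u (v + p)) ^ 2) := by
            congr 1; ext v
            rw [show v + p + (x - p) = x + v by abel, add_comm v p]
        _ = ∫⁻ v, ENNReal.ofReal ((u (v + (x - p)) - u v) ^ 2) :=
            lintegral_add_right_eq_self
              (fun v => ENNReal.ofReal ((u (v + (x - p)) - u v) ^ 2)) p
        _ ≤ _ := transl_bound u hu (x - p)
        _ ≤ _ := by
            rw [dist_eq_norm] at hxp
            gcongr
    calc ENNReal.ofReal (u x ^ 2) ≤ ENNReal.ofReal (2 * (m - u x) ^ 2 + 2 * m ^ 2) := by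
          apply ENNReal.ofReal_le_ofReal
          nlinarith [sq_nonneg (2 * m - u x)]
      _ = 2 * ENNReal.ofReal ((m - u x) ^ 2) + 2 * ENNReal.ofReal (m ^ 2) := by
          rw [ENNReal.ofReal_add (by positivity) (by positivity),
            ENNReal.ofReal_mul (by norm_num), ENNReal.ofReal_mul (by norm_num)]
          simp
      _ ≤ _ := by
          gcongr
          exact j2.trans b2
  have first : ∫⁻ x, ∫⁻ v, ENNReal.ofReal ((u (x + v) - u x) ^ 2) ∂μ ≤
      ENNReal.ofReal (h ^ 2) * G := by
    rw [lintegral_lintegral_swap]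
    · calc _ ≤ ∫⁻ v, ENNReal.ofReal (‖v‖ ^ 2) * G ∂μ :=
            lintegral_mono fun v => transl_bound u hu v
        _ ≤ ∫⁻ v, ENNReal.ofReal (h ^ 2) * G ∂μ := by
            apply lintegral_mono_ae
            apply Measure.ae_smul_measure
            refine (ae_restrict_iff' measurableSet_ball).2 (ae_of_all _ fun v hv => ?_)
            rw [mem_ball_zero_iff] at hv
            gcongr
        _ = _ := by simp
    · apply Measurable.aemeasurable
      apply ENNReal.measurable_ofReal.comp
      apply Continuous.measurable
      fun_prop
  calc _ ≤ ∫⁻ x in Metric.closedBall (0 : Ed d) R,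
      (2 * ∫⁻ v, ENNReal.ofReal ((u (x + v) - u x) ^ 2) ∂μ +
      2 * ((volume B)⁻¹ * (ENNReal.ofReal (δ ^ 2) * G))) :=
        setLIntegral_mono' measurableSet_closedBall key
    _ ≤ 2 * (ENNReal.ofReal (h ^ 2) * G) + 2 * ((volume B)⁻¹ * (ENNReal.ofReal (δ ^ 2) * G))
        * volume (Metric.closedBall (0 : Ed d) R) := by
        rw [lintegral_add_right _ measurable_const, setLIntegral_const]
        gcongr
        rw [lintegral_const_mul' _ _ (by simp)]
        gcongr
        exact (setLIntegral_le_lintegral _ _).trans first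
    _ = _ := by ring

/-- The effective Hardy potential `div F - |F|^2` of the field `F x = b (1+|x|^2)^(-s) x`. -/
def hardyP (d : ℕ) (b s : ℝ) (x : Ed d) : ℝ :=
  b * (d * (1 + ‖x‖ ^ 2) ^ (-s) - 2 * s * ‖x‖ ^ 2 * (1 + ‖x‖ ^ 2) ^ (-s - 1))
    - ‖x‖ ^ 2 * ((1 + ‖x‖ ^ 2) ^ (-s)) ^ 2

lemma continuous_japanese (d : ℕ) (s : ℝ) : Continuous fun x : Ed d => (1 + ‖x‖ ^ 2) ^ s := by
  apply Continuous.rpow_const (by fun_prop)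
  intro x
  left
  positivity

lemma continuous_hardyP (d : ℕ) (b s : ℝ) : Continuous (hardyP d b s) := by
  unfold hardyP
  have h1 := continuous_japanese d (-s)
  have h2 := continuous_japanese d (-s - 1)
  fun_prop

lemma integrable_of_support {d : ℕ} {u f : Ed d → ℝ} (hs : HasCompactSupport u)
    (hf : Continuous f) (hz : ∀ x, x ∉ tsupport u → f x = 0) : Integrable f :=
  hf.integrable_of_hasCompactSupport (HasCompactSupport.intro hs hz)

lemma hardy {d : ℕ} (b s : ℝ) (hb : b ^ 2 = 1) (u : Ed d → ℝ) (hu : ContDiff ℝ 1 u)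
    (hs : HasCompactSupport u) :
    ∫ x, hardyP d b s x * u x ^ 2 ≤ ∫ x, ‖fderiv ℝ u x‖ ^ 2 := by
  have huc := hu.continuous
  have hdc : Continuous (fderiv ℝ u) := hu.continuous_fderiv (by norm_num)
  have hg := continuous_japanese d (-s)
  have hg1 := continuous_japanese d (-s - 1)
  have z1 : ∀ x, x ∉ tsupport u → u x = 0 := fun x hx => image_eq_zero_of_notMem_tsupport hx
  have z2 : ∀ x, x ∉ tsupport u → fderiv ℝ u x = 0 := fun x hx =>
    image_eq_zero_of_notMem_tsupport fun h => hx (tsupport_fderiv_subset ℝ h)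
  let e : Fin d → Ed d := fun i => EuclideanSpace.single i 1
  let g : Ed d → ℝ := fun x => (1 + ‖x‖ ^ 2) ^ (-s)
  let F : Fin d → Ed d → ℝ := fun i x => b * (x i * g x)
  let F' : Fin d → Ed d → ℝ := fun i x =>
    b * (g x - 2 * s * (x i) ^ 2 * (1 + ‖x‖ ^ 2) ^ (-s - 1))
  have hgc : Continuous g := hg
  have hFc : ∀ i, Continuous (F i) := fun i => by fun_prop
  have hFc' : ∀ i, Continuous (F' i) := fun i => by fun_prop
  have hF : ∀ i x, HasLineDerivAt ℝ (F i) (F' i x) x (e i) := by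
    intro i x
    have h1 : HasFDerivAt (fun x : Ed d => 1 + ‖x‖ ^ 2) (2 • innerSL ℝ x) x :=
      (hasStrictFDerivAt_norm_sq x).hasFDerivAt.const_add 1
    have h2 : HasFDerivAt g _ x := h1.rpow_const (p := -s) (Or.inl (by positivity))
    have h3 : HasFDerivAt (fun x : Ed d => x i) (EuclideanSpace.proj i : Ed d →L[ℝ] ℝ) x :=
      (EuclideanSpace.proj i : Ed d →L[ℝ] ℝ).hasFDerivAt
    have h4 : HasLineDerivAt ℝ (F i) _ x (e i) := ((h3.mul h2).const_mul b).hasLineDerivAt (e i)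
    convert h4 using 1
    simp [F', e, EuclideanSpace.inner_single_right]
    ring
  have hI : ∀ i, ∫ x, u x ^ 2 * F' i x = - ∫ x, (2 * u x * fderiv ℝ u x (e i)) * F i x := by
    intro i
    have hFi := hFc i
    have hFi' := hFc' i
    refine integral_bilinear_hasLineDerivAt_right_eq_neg_left_of_integrable
      (B := ContinuousLinearMap.mul ℝ ℝ) (v := e i) (f := fun x => u x ^ 2)
      (f' := fun x => 2 * u x * fderiv ℝ u x (e i)) (g := F i) (g' := F' i)
      ?_ ?_ ?_ ?_ (fun x _ => hF i x)
    · refine integrable_of_support hs ?_ ?_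
      · simp only [ContinuousLinearMap.mul_apply']; fun_prop
      · intro x hx; simp [z1 x hx]
    · refine integrable_of_support hs ?_ ?_
      · simp only [ContinuousLinearMap.mul_apply']; fun_prop
      · intro x hx; simp [z1 x hx]
    · refine integrable_of_support hs ?_ ?_
      · simp only [ContinuousLinearMap.mul_apply']; fun_prop
      · intro x hx; simp [z1 x hx]
    · intro x _
      have := (((hu.differentiable (by norm_num)) x).hasFDerivAt.pow 2).hasLineDerivAt (e i)
      convert this using 1
      simp
  have int1 : ∀ i, Integrable fun x => u x ^ 2 * F' i x := fun i => by
    have hFi' := hFc' i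
    exact integrable_of_support hs (by fun_prop) (fun x hx => by simp [z1 x hx])
  have int2 : ∀ i, Integrable fun x => (2 * u x * fderiv ℝ u x (e i)) * F i x := fun i => by
    have hFi := hFc i
    exact integrable_of_support hs (by fun_prop) (fun x hx => by simp [z1 x hx])
  have int3 : Integrable fun x => hardyP d b s x * u x ^ 2 := by
    have := continuous_hardyP d b s
    exact integrable_of_support hs (by fun_prop) (fun x hx => by simp [z1 x hx])
  have int4 : Integrable fun x => ‖fderiv ℝ u x‖ ^ 2 :=
    integrable_of_support hs (by fun_prop) (fun x hx => by simp [z2 x hx])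
  have hsum : ∫ x, ∑ i, (u x ^ 2 * F' i x + (2 * u x * fderiv ℝ u x (e i)) * F i x) = 0 := by
    rw [integral_finsetSum (f := fun i x => u x ^ 2 * F' i x +
      (2 * u x * fderiv ℝ u x (e i)) * F i x) _ (fun i _ => (int1 i).add (int2 i))]
    apply Finset.sum_eq_zero
    intro i _
    rw [integral_add (int1 i) (int2 i), hI i]
    ring
  have int5 : Integrable fun x =>
      ∑ i, (u x ^ 2 * F' i x + (2 * u x * fderiv ℝ u x (e i)) * F i x) :=
    integrable_finsetSum _ (fun i _ => (int1 i).add (int2 i))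
  have hpt : ∀ x, hardyP d b s x * u x ^ 2 ≤ ‖fderiv ℝ u x‖ ^ 2 +
      ∑ i, (u x ^ 2 * F' i x + (2 * u x * fderiv ℝ u x (e i)) * F i x) := by
    intro x
    have n1 : ‖fderiv ℝ u x‖ ^ 2 = ∑ i, (fderiv ℝ u x (e i)) ^ 2 := by
      rw [← norm_gradient_eq, EuclideanSpace.norm_sq_eq]
      refine Finset.sum_congr rfl fun i _ => ?_
      rw [Real.norm_eq_abs, sq_abs]
      congr 1
      have : inner ℝ (gradient u x) (e i) = fderiv ℝ u x (e i) := by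
        simp [gradient]
      rw [← this]
      simp only [e, EuclideanSpace.inner_single_right]
      simp
    have n2 : ‖x‖ ^ 2 = ∑ i, x i ^ 2 := by
      rw [EuclideanSpace.norm_sq_eq]; simp
    have n3 : 0 ≤ ∑ i, (fderiv ℝ u x (e i) + F i x * u x) ^ 2 :=
      Finset.sum_nonneg fun i _ => sq_nonneg _
    have n4 : ∑ i, F' i x = b * (d * g x - 2 * s * ‖x‖ ^ 2 * (1 + ‖x‖ ^ 2) ^ (-s - 1)) := by
      simp only [F']
      rw [← Finset.mul_sum, Finset.sum_sub_distrib, ← Finset.sum_mul, ← Finset.mul_sum, ← n2]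
      simp
    have n5 : ∑ i, (F i x) ^ 2 = ‖x‖ ^ 2 * g x ^ 2 := by
      rw [n2, Finset.sum_mul]
      refine Finset.sum_congr rfl fun i _ => ?_
      simp only [F]
      linear_combination (x i * g x) ^ 2 * hb
    have n6 : hardyP d b s x = ∑ i, F' i x - ∑ i, (F i x) ^ 2 := by
      rw [n4, n5]; rfl
    rw [n6, n1, ← sub_nonneg]
    refine n3.trans_eq ?_
    rw [sub_mul, Finset.sum_mul, Finset.sum_mul, ← Finset.sum_add_distrib,
      ← Finset.sum_sub_distrib, ← Finset.sum_sub_distrib]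
    refine Finset.sum_congr rfl fun i _ => ?_
    ring
  have := integral_mono int3 (int4.add int5) hpt
  simp only [Pi.add_apply] at this
  rw [integral_add int4 int5, hsum, add_zero] at this
  exact this

lemma hardyP_far (d : ℕ) (c ρ : ℝ) (hc : 0 < c) (hρ : 2 < ρ) :
    ∃ b s R : ℝ, b ^ 2 = 1 ∧ ∀ x : Ed d, R < ‖x‖ →
      2 * (c * (1 + ‖x‖) ^ (-ρ)) ≤ hardyP d b s x := by
  obtain ⟨s, hs1, hs2, hsd⟩ : ∃ s : ℝ, 1 < s ∧ s < ρ / 2 ∧ (d : ℝ) - 2 * s ≠ 0 := by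
    by_cases h : (d : ℝ) - 2 * ((1 + ρ / 2) / 2) = 0
    · refine ⟨(1 + (1 + ρ / 2) / 2) / 2, by linarith, by linarith, fun h' => ?_⟩
      linarith
    · exact ⟨(1 + ρ / 2) / 2, by linarith, by linarith, h⟩
  obtain ⟨b, hb, hbd⟩ : ∃ b : ℝ, b ^ 2 = 1 ∧ 0 < b * (d - 2 * s) := by
    rcases lt_or_gt_of_ne hsd with h | h
    · exact ⟨-1, by norm_num, by linarith⟩
    · exact ⟨1, by norm_num, by linarith⟩
  have hlim : Tendsto (fun t : ℝ => 2 * s * t ^ (-1 : ℝ) + t ^ (-(s - 1)) +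
      2 * c * t ^ (-(ρ / 2 - s))) atTop (𝓝 0) := by
    have h1 := (tendsto_rpow_neg_atTop (y := 1) one_pos).const_mul (2 * s)
    have h2 := tendsto_rpow_neg_atTop (y := s - 1) (by linarith)
    have h3 := (tendsto_rpow_neg_atTop (y := ρ / 2 - s) (by linarith)).const_mul (2 * c)
    simpa using (h1.add h2).add h3
  obtain ⟨T, hT⟩ := eventually_atTop.1 (hlim.eventually (gt_mem_nhds hbd))
  refine ⟨b, s, max T 1, hb, fun x hx => ?_⟩
  have hx1 : 1 < ‖x‖ := (le_max_right _ _).trans_lt hx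
  have hxT : T < ‖x‖ := (le_max_left _ _).trans_lt hx
  set t := 1 + ‖x‖ ^ 2 with ht
  have ht0 : 0 < t := by positivity
  have htT : T ≤ t := by nlinarith
  have h := hT t htT
  have e0 : hardyP d b s x = b * (d * t ^ (-s) - 2 * s * (t - 1) * t ^ (-s - 1))
    - (t - 1) * (t ^ (-s)) ^ 2 := by
    unfold hardyP
    rw [← ht, show ‖x‖ ^ 2 = t - 1 by rw [ht]; ring]
  have e1 : t * t ^ (-s - 1) = t ^ (-s) := by
    rw [← rpow_one_add' ht0.le (by linarith)]; ring_nf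
  have e1' : t ^ (-s - 1) = t ^ (-s) * t ^ (-1 : ℝ) := by
    rw [← rpow_add ht0]; ring_nf
  have e2 : t * t ^ (-s) = t ^ (-(s - 1)) := by
    rw [← rpow_one_add' ht0.le (by linarith)]; ring_nf
  have e3 : (1 + ‖x‖) ^ (-ρ) ≤ t ^ (-s) * t ^ (-(ρ / 2 - s)) := by
    rw [← rpow_add ht0, show -s + -(ρ / 2 - s) = (1 / 2) * (-ρ) by ring, rpow_mul ht0.le]
    apply rpow_le_rpow_of_nonpos (by positivity) _ (by linarith)
    rw [← sqrt_eq_rpow]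
    apply sqrt_le_iff.2 ⟨by positivity, by rw [ht]; nlinarith⟩
  have hp : 0 < t ^ (-s) := rpow_pos_of_pos ht0 _
  have hq : 0 < t ^ (-1 : ℝ) := rpow_pos_of_pos ht0 _
  have hbb : -1 ≤ b := by nlinarith
  have e4 : hardyP d b s x = t ^ (-s) * (b * (d - 2 * s) + b * (2 * s * t ^ (-1 : ℝ))
      - t ^ (-(s - 1)) + t ^ (-s)) := by
    rw [e0, ← e2]
    have : (t - 1) * t ^ (-s - 1) = t ^ (-s) - t ^ (-s) * t ^ (-1 : ℝ) := by
      rw [sub_mul, e1, e1', one_mul]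
    linear_combination (-b * 2 * s) * this
  rw [e4]
  calc 2 * (c * (1 + ‖x‖) ^ (-ρ)) ≤ 2 * (c * (t ^ (-s) * t ^ (-(ρ / 2 - s)))) := by gcongr
    _ = t ^ (-s) * (2 * c * t ^ (-(ρ / 2 - s))) := by ring
    _ ≤ _ := by
      gcongr
      have : 0 ≤ (b + 1) * (2 * s * t ^ (-1 : ℝ)) := by
        apply mul_nonneg (by linarith)
        positivity
      linarith

/-- Proposition 2.1 (Cwikel–Lieb–Rozenblum type): finiteness of the discrete spectrum for
potentials whose negative part decays faster than `|x|^{-2}`. -/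
theorem finite_discrete_spectrum_fast_decay
    (d : ℕ) (hd : 1 ≤ d) (V : Ed d → ℝ) (hVmeas : Measurable V)
    (M : ℝ) (hVbd : ∀ x, |V x| ≤ M)
    (hV0 : Tendsto V (cocompact (Ed d)) (𝓝 0))
    (c ρ : ℝ) (hc : 0 < c) (hρ : 2 < ρ)
    (hneg : ∀ x : Ed d, max (-V x) 0 ≤ c * (1 + ‖x‖) ^ (-ρ)) :
    schN d V 0 < ⊤ := by
  obtain ⟨b, s, R, hb, hfar⟩ := hardyP_far d c ρ hc hρ
  set K := Metric.closedBall (0 : Ed d) R with hK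
  have hKc : IsCompact K := isCompact_closedBall _ _
  obtain ⟨A, hA⟩ := hKc.exists_bound_of_continuousOn (continuous_hardyP d b s).continuousOn
  -- lower bound on the effective potential
  let C : ℝ := max A 0 + 2 * max M 0 + 1
  have hC : 0 < C := by positivity
  have hlow : ∀ x, -(K.indicator (fun _ => C) x) ≤ hardyP d b s x + 2 * V x := by
    intro x
    by_cases hx : x ∈ K
    · rw [indicator_of_mem hx]
      have h1 := (abs_le.1 (hA x hx)).1
      have h2 := (abs_le.1 (hVbd x)).1
      have h3 := le_max_left A 0
      have h4 := le_max_left M 0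
      simp only [C]
      linarith
    · rw [indicator_of_notMem hx]
      have : R < ‖x‖ := by simpa [K] using hx
      have h1 := hfar x this
      have h2 := (le_max_left _ _).trans (hneg x)
      linarith
  -- choice of the scales
  let h : ℝ := Real.sqrt (1 / (4 * C))
  have hh : 0 < h := Real.sqrt_pos.2 (by positivity)
  have hh2 : h ^ 2 = 1 / (4 * C) := Real.sq_sqrt (by positivity)
  set B := Metric.ball (0 : Ed d) h with hB
  have hB0 : volume B ≠ 0 := (Metric.measure_ball_pos volume 0 hh).ne'
  have hBt : volume B ≠ ⊤ := measure_ball_lt_top.ne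
  let q : ℝ := ((volume B)⁻¹ * volume K).toReal
  have hqt : (volume B)⁻¹ * volume K ≠ ⊤ :=
    ENNReal.mul_ne_top (ENNReal.inv_ne_top.2 hB0) hKc.measure_lt_top.ne
  have hq : 0 ≤ q := ENNReal.toReal_nonneg
  let δ : ℝ := Real.sqrt (1 / (4 * C * (q + 1)))
  have hδ : 0 < δ := Real.sqrt_pos.2 (by positivity)
  have hδ2 : δ ^ 2 = 1 / (4 * C * (q + 1)) := Real.sq_sqrt (by positivity)
  obtain ⟨t, -, htf, htc⟩ := hKc.finite_cover_balls hδ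
  have htc' : ∀ x ∈ K, ∃ p ∈ t, dist x p < δ := by
    intro x hx
    simpa using htc hx
  have : Fintype t := htf.fintype
  -- the main inequality
  have main : ∀ u : Ed d → ℝ, ContDiff ℝ 1 u → HasCompactSupport u →
      (∀ p ∈ t, ∫ v in B, u (p + v) = 0) →
      0 ≤ ∫ x, (‖gradient u x‖ ^ 2 + V x * u x ^ 2) := by
    intro u hu hs h0
    have huc := hu.continuous
    have hdc : Continuous (fderiv ℝ u) := hu.continuous_fderiv (by norm_num)
    have z1 : ∀ x, x ∉ tsupport u → u x = 0 := fun x hx => image_eq_zero_of_notMem_tsupport hx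
    have z2 : ∀ x, x ∉ tsupport u → fderiv ℝ u x = 0 := fun x hx =>
      image_eq_zero_of_notMem_tsupport fun h => hx (tsupport_fderiv_subset ℝ h)
    have i1 : Integrable fun x => ‖fderiv ℝ u x‖ ^ 2 :=
      integrable_of_support hs (by fun_prop) (fun x hx => by simp [z2 x hx])
    have i2 : Integrable fun x => u x ^ 2 :=
      integrable_of_support hs (by fun_prop) (fun x hx => by simp [z1 x hx])
    have i3 : Integrable fun x => V x * u x ^ 2 :=
      i2.bdd_mul hVmeas.aestronglyMeasurable (ae_of_all _ hVbd)
    have i4 : Integrable fun x => hardyP d b s x * u x ^ 2 := by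
      have := continuous_hardyP d b s
      exact integrable_of_support hs (by fun_prop) (fun x hx => by simp [z1 x hx])
    set G := ∫ x, ‖fderiv ℝ u x‖ ^ 2 with hG
    have hG0 : 0 ≤ G := integral_nonneg fun x => by positivity
    have hhardy := hardy b s hb u hu hs
    rw [← hG] at hhardy
    have hloc := local_bound u hu h δ R hh hδ t htc' h0
    rw [← ofReal_integral_eq_lintegral_ofReal i1 (ae_of_all _ fun x => by positivity),
      ← ofReal_integral_eq_lintegral_ofReal i2.integrableOn (ae_of_all _ fun x => by positivity),
      ← hG, ← hB, ← hK] at hloc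
    have hconst : 2 * (ENNReal.ofReal (h ^ 2) + (volume B)⁻¹ * ENNReal.ofReal (δ ^ 2)
        * volume K) = ENNReal.ofReal (2 * (h ^ 2 + δ ^ 2 * q)) := by
      rw [ENNReal.ofReal_mul (by norm_num), ENNReal.ofReal_add (by positivity) (by positivity),
        ENNReal.ofReal_mul (by positivity), ENNReal.ofReal_toReal hqt]
      simp only [ENNReal.ofReal_ofNat]
      ring
    rw [hconst, ← ENNReal.ofReal_mul (by positivity),
      ENNReal.ofReal_le_ofReal_iff (by positivity)] at hloc
    have hsmall : C * (2 * (h ^ 2 + δ ^ 2 * q)) ≤ 1 := by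
      rw [hh2, hδ2]
      have : q / (q + 1) ≤ 1 := (div_le_one (by positivity)).2 (by linarith)
      have e : C * (2 * (1 / (4 * C) + 1 / (4 * C * (q + 1)) * q)) = 1 / 2 + q / (q + 1) / 2 := by
        field_simp
        ring
      rw [e]; linarith
    have hlocC : C * ∫ x in K, u x ^ 2 ≤ G := by
      calc _ ≤ C * (2 * (h ^ 2 + δ ^ 2 * q) * G) := by gcongr
        _ = C * (2 * (h ^ 2 + δ ^ 2 * q)) * G := by ring
        _ ≤ 1 * G := by gcongr
        _ = G := one_mul G
    have hKm : MeasurableSet K := measurableSet_closedBall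
    have i5 : Integrable (K.indicator fun x => C * u x ^ 2) :=
      (i2.const_mul C).indicator hKm
    have hmono : ∫ x, -(K.indicator (fun x => C * u x ^ 2) x) ≤
        ∫ x, (hardyP d b s x * u x ^ 2 + 2 * (V x * u x ^ 2)) := by
      refine integral_mono i5.neg (i4.add (i3.const_mul 2)) fun x => ?_
      have := mul_le_mul_of_nonneg_right (hlow x) (sq_nonneg (u x))
      by_cases hx : x ∈ K
      · simp only [indicator_of_mem hx] at this ⊢
        linarith
      · simp only [indicator_of_notMem hx] at this ⊢
        linarith
    rw [integral_neg, integral_indicator hKm, integral_const_mul,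
      integral_add i4 (i3.const_mul 2), integral_const_mul] at hmono
    simp only [norm_gradient_eq]
    rw [integral_add i1 i3, ← hG]
    linarith
  -- the counting argument
  have hle : schN d V 0 ≤ (Fintype.card t : ℕ∞) := by
    refine iSup_le fun F => ?_
    obtain ⟨F, hF1, hF2⟩ := F
    simp only [Nat.cast_le]
    by_contra! hlt
    have : FiniteDimensional ℝ F := FiniteDimensional.of_finrank_pos (by omega)
    have hint : ∀ u ∈ F, ∀ p : Ed d, IntegrableOn (fun v => u (p + v)) B := by
      intro u hu p
      have hc : Continuous fun v => u (p + v) :=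
        (hF1 u hu).1.continuous.comp (by fun_prop)
      exact (hc.continuousOn.integrableOn_compact (isCompact_closedBall (0 : Ed d) h)).mono_set
        Metric.ball_subset_closedBall
    let L : F →ₗ[ℝ] (t → ℝ) :=
      { toFun := fun u p => ∫ v in B, u.1 (p.1 + v)
        map_add' := by
          intro u w
          ext p
          exact integral_add (hint u.1 u.2 p.1) (hint w.1 w.2 p.1)
        map_smul' := by
          intro a u
          ext p
          exact integral_const_mul a _ }
    have hker : LinearMap.ker L ≠ ⊥ := L.ker_ne_bot_of_finrank_lt (by simpa using hlt)
    obtain ⟨u, huL, hu0⟩ := (Submodule.ne_bot_iff _).1 hker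
    have hu0' : u.1 ≠ 0 := fun h => hu0 (Subtype.ext h)
    have h1 := hF2 u.1 u.2 hu0'
    rw [zero_mul] at h1
    have h2 := main u.1 ((hF1 u.1 u.2).1.of_le (by exact_mod_cast le_top)) (hF1 u.1 u.2).2 (by
      intro p hp
      exact congrFun (LinearMap.mem_ker.1 huL) ⟨p, hp⟩)
    linarith
  exact hle.trans_lt (ENat.natCast_lt_top _)

end
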